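/- Let m ≥ 3 be odd and assume k = 2n+1 is prime. Then the Cayley digraph on H_k/N_k with connection set {sN_k : s ∈ P_k} (arc set {(g, sg) : g ∈ H_k/N_k, s ∈ P_k N_k/N_k}) is a connected oriented digraph (its arc relation is asymmetric) of out-valency k, with exactly m^k vertices; it admits a group of automorphisms acting transitively on its vertices and on its arcs (namely the group generated by right translations by H_k/N_k and the automorphism induced by b); and the cosets of the image of ⟨z⟩ in H_k/N_k form a system of blocks of imprimitivity of size m for this group. -/

import Mathlib

/-- The discrete Heisenberg group `H_k` (`k = 2n+1`), realized concretely on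
`(Fin n → ℤ) × (Fin n → ℤ) × ℤ`. -/
@[ext]
structure Heis (n : ℕ) where
  a : Fin n → ℤ
  b : Fin n → ℤ
  c : ℤ

namespace Heis

variable {n : ℕ}

instance : Mul (Heis n) :=
  ⟨fun g h => ⟨g.a + h.a, g.b + h.b, g.c + h.c + ∑ i, g.a i * h.b i⟩⟩

instance : One (Heis n) := ⟨⟨0, 0, 0⟩⟩

instance : Inv (Heis n) :=
  ⟨fun g => ⟨-g.a, -g.b, -g.c + ∑ i, g.a i * g.b i⟩⟩

@[simp] lemma mul_a (g h : Heis n) : (g * h).a = g.a + h.a := rfl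
@[simp] lemma mul_b (g h : Heis n) : (g * h).b = g.b + h.b := rfl
@[simp] lemma mul_c (g h : Heis n) :
    (g * h).c = g.c + h.c + ∑ i, g.a i * h.b i := rfl
@[simp] lemma one_a : (1 : Heis n).a = 0 := rfl
@[simp] lemma one_b : (1 : Heis n).b = 0 := rfl
@[simp] lemma one_c : (1 : Heis n).c = 0 := rfl
@[simp] lemma inv_a (g : Heis n) : g⁻¹.a = -g.a := rfl
@[simp] lemma inv_b (g : Heis n) : g⁻¹.b = -g.b := rfl
@[simp] lemma inv_c (g : Heis n) : g⁻¹.c = -g.c + ∑ i, g.a i * g.b i := rfl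

instance : Group (Heis n) where
  mul_assoc g h k := by
    ext <;> simp [Finset.sum_add_distrib, add_mul, mul_add] <;> ring
  one_mul g := by ext <;> simp
  mul_one g := by ext <;> simp
  inv_mul_cancel g := by
    ext <;> simp [Finset.sum_add_distrib, neg_mul] <;> ring

end Heis

/-- The generators `x_1, …, x_{2n}` of the Heisenberg group: for `1 ≤ i ≤ n`,
`x_i = (e_i, 0, 0)`; for `n+1 ≤ i ≤ 2n`, `x_i = (0, e_{i-n}, 0)`. -/
def xg (n : ℕ) (i : ℕ) : Heis n :=
  if h : 1 ≤ i ∧ i ≤ n then ⟨Pi.single (⟨i - 1, by omega⟩ : Fin n) 1, 0, 0⟩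
  else if h' : n + 1 ≤ i ∧ i ≤ 2 * n then
    ⟨0, Pi.single (⟨i - n - 1, by omega⟩ : Fin n) 1, 0⟩
  else 1

/-- The central element `z = (0,0,1)`. -/
def zz (n : ℕ) : Heis n := ⟨0, 0, 1⟩

/-- The automorphism `t : (a,b,c) ↦ (-a,-b,c)` of the Heisenberg group. -/
def tAut (n : ℕ) : MulAut (Heis n) where
  toFun g := ⟨-g.a, -g.b, g.c⟩
  invFun g := ⟨-g.a, -g.b, g.c⟩
  left_inv g := by ext <;> simp
  right_inv g := by ext <;> simp
  map_mul' g h := by ext <;> simp <;> ring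

/-- The subgroup `⟨t⟩` of `Aut(H_k)` generated by `t`. -/
abbrev tsub (n : ℕ) : Subgroup (MulAut (Heis n)) := Subgroup.zpowers (tAut n)

/-- The group `R_k = H_k ⋊ ⟨t⟩`. -/
abbrev RR (n : ℕ) := SemidirectProduct (Heis n) (tsub n) (tsub n).subtype

/-- The element `t` of `R_k`. -/
def tR (n : ℕ) : RR n := SemidirectProduct.inr ⟨tAut n, Subgroup.mem_zpowers _⟩

/-- The defining conditions for the automorphism `b` of `H_k`. -/
def IsB (n : ℕ) (b : MulAut (Heis n)) : Prop :=
  (∀ i : ℕ, 1 ≤ i → i ≤ n - 1 → b (xg n i) = xg n (i + 1) * xg n (n + 1)) ∧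
  (∀ i : ℕ, n ≤ i → i ≤ 2 * n - 1 → b (xg n i) = xg n (i + 1)) ∧
  b (xg n (2 * n)) =
    (xg n 1)⁻¹ * ((List.range n).map fun j => (xg n (n + 1 + j))⁻¹).prod

/-- The defining conditions for the automorphism `B` of `R_k` extending `b`. -/
def IsBR (n : ℕ) (b : MulAut (Heis n)) (B : MulAut (RR n)) : Prop :=
  (∀ h : Heis n, B (SemidirectProduct.inl h) = SemidirectProduct.inl (b h)) ∧
  B (tR n) = SemidirectProduct.inl (xg n (n + 1)) * tR n

/-- The generating set `{x_1^m, …, x_{2n}^m, z^m}` of the subgroup `N_k`. -/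
def Ngen (n m : ℕ) : Set (Heis n) :=
  {g | (∃ i : ℕ, 1 ≤ i ∧ i ≤ 2 * n ∧ g = xg n i ^ m) ∨ g = zz n ^ m}

/-- The subgroup `N_k = ⟨x_1^m, …, x_{2n}^m, z^m⟩` of `H_k`. -/
def Nsub (n m : ℕ) : Subgroup (Heis n) := Subgroup.closure (Ngen n m)

/-- The arc relation of the Cayley digraph on `H_k/N` with connection set the
image of `P_k = {b^j(x_{n+1}) : 0 ≤ j ≤ k-1}`: `(g, s·g)` for `s` in the image
of `P_k`. -/
def PArc (n k : ℕ) (b : MulAut (Heis n)) (N : Subgroup (Heis n)) [N.Normal]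
    (g h : Heis n ⧸ N) : Prop :=
  ∃ j < k, h = (QuotientGroup.mk ((b ^ j) (xg n (n + 1))) : Heis n ⧸ N) * g

/-- The group of permutations of `H_k/N` generated by right translations
together with the automorphism induced by `b`. -/
def CayGrp (n : ℕ) (b : MulAut (Heis n)) (N : Subgroup (Heis n)) [N.Normal]
    (hbN : Subgroup.map (b : Heis n →* Heis n) N = N) :
    Subgroup (Equiv.Perm (Heis n ⧸ N)) :=
  Subgroup.closure
    (Set.range (fun h : Heis n ⧸ N => Equiv.mulRight h) ∪
      {(QuotientGroup.congr N N (b : Heis n ≃* Heis n) hbN).toEquiv})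

/-- The coset of the image of `⟨z⟩` in `H_k/N` containing `g`. -/
def zCoset (n : ℕ) (N : Subgroup (Heis n)) [N.Normal] (g : Heis n ⧸ N) :
    Set (Heis n ⧸ N) :=
  {q | ∃ c : ℤ, q = (QuotientGroup.mk (zz n ^ c) : Heis n ⧸ N) * g}

open Heis in
lemma xg_lo (n i : ℕ) (hi : i < n) : xg n (i+1) = ⟨Pi.single ⟨i, hi⟩ 1, 0, 0⟩ := by
  unfold xg; rw [dif_pos (by omega)]; simp

lemma xg_hi (n i : ℕ) (hi : i < n) : xg n (n+1+i) = ⟨0, Pi.single ⟨i, hi⟩ 1, 0⟩ := by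
  unfold xg; rw [dif_neg (by omega), dif_pos (by omega)]
  have : n + 1 + i - n - 1 = i := by omega
  simp [this]

lemma pow_lo (n : ℕ) (v : Fin n → ℤ) (m : ℕ) :
    (⟨v, 0, 0⟩ : Heis n) ^ m = ⟨m • v, 0, 0⟩ := by
  induction m with
  | zero => ext <;> simp
  | succ m ih => rw [pow_succ, ih]; ext <;> simp [add_mul]

lemma pow_hi (n : ℕ) (v : Fin n → ℤ) (m : ℕ) :
    (⟨0, v, 0⟩ : Heis n) ^ m = ⟨0, m • v, 0⟩ := by
  induction m with
  | zero => ext <;> simp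
  | succ m ih => rw [pow_succ, ih]; ext <;> simp [add_mul]

lemma pow_z (n : ℕ) (c : ℤ) (m : ℕ) :
    (⟨0, 0, c⟩ : Heis n) ^ m = ⟨0, 0, m * c⟩ := by
  induction m with
  | zero => ext <;> simp
  | succ m ih => rw [pow_succ, ih]; ext <;> simp [add_mul]

lemma zpow_z (n : ℕ) (c : ℤ) (m : ℤ) :
    (⟨0, 0, c⟩ : Heis n) ^ m = ⟨0, 0, m * c⟩ := by
  obtain ⟨k, rfl | rfl⟩ := m.eq_nat_or_neg
  · rw [zpow_natCast, pow_z]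
  · rw [zpow_neg, zpow_natCast, pow_z]; ext <;> simp

lemma mem_of_gens (n m : ℕ) (S : Subgroup (Heis n)) (h : Ngen n m ⊆ S) (g : Heis n)
    (ha : ∀ i, (m : ℤ) ∣ g.a i) (hb : ∀ i, (m : ℤ) ∣ g.b i) (hc : (m : ℤ) ∣ g.c) : g ∈ S := by
  choose a ha using ha
  choose b hb using hb
  obtain ⟨c, hc⟩ := hc
  let A : AddSubgroup (Fin n → ℤ) :=
    { carrier := {v | (⟨m • v, 0, 0⟩ : Heis n) ∈ S}
      zero_mem' := by
        have : (⟨m • (0 : Fin n → ℤ), 0, 0⟩ : Heis n) = 1 := by ext <;> simp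
        change _ ∈ S
        rw [this]; exact S.one_mem
      add_mem' := by
        intro v w hv hw
        have := S.mul_mem hv hw
        change (⟨m • (v + w), 0, 0⟩ : Heis n) ∈ S
        convert this using 1
        ext <;> simp [mul_add]
      neg_mem' := by
        intro v hv
        have := S.inv_mem hv
        change (⟨m • (-v), 0, 0⟩ : Heis n) ∈ S
        convert this using 1
        ext <;> simp }
  let B : AddSubgroup (Fin n → ℤ) :=
    { carrier := {v | (⟨0, m • v, 0⟩ : Heis n) ∈ S}
      zero_mem' := by
        have : (⟨0, m • (0 : Fin n → ℤ), 0⟩ : Heis n) = 1 := by ext <;> simp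
        change _ ∈ S
        rw [this]; exact S.one_mem
      add_mem' := by
        intro v w hv hw
        have := S.mul_mem hv hw
        change (⟨0, m • (v + w), 0⟩ : Heis n) ∈ S
        convert this using 1
        ext <;> simp [mul_add]
      neg_mem' := by
        intro v hv
        have := S.inv_mem hv
        change (⟨0, m • (-v), 0⟩ : Heis n) ∈ S
        convert this using 1
        ext <;> simp }
  have key : ∀ (A : AddSubgroup (Fin n → ℤ)), (∀ i, Pi.single i 1 ∈ A) → ∀ v, v ∈ A := by
    intro A hA v
    rw [← Finset.univ_sum_single v]
    refine A.sum_mem fun i _ => ?_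
    have : (Pi.single i (v i) : Fin n → ℤ) = v i • Pi.single i 1 := by
      rw [← Pi.single_smul]; simp
    rw [this]
    exact A.zsmul_mem (hA i) _
  have h1 : a ∈ A := by
    refine key A (fun i => ?_) a
    change (⟨m • Pi.single i 1, 0, 0⟩ : Heis n) ∈ S
    rw [← pow_lo, ← xg_lo n i i.2]
    exact h (Or.inl ⟨i+1, by omega, by omega, rfl⟩)
  have h2 : b ∈ B := by
    refine key B (fun i => ?_) b
    change (⟨0, m • Pi.single i 1, 0⟩ : Heis n) ∈ S
    rw [← pow_hi, ← xg_hi n i i.2]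
    exact h (Or.inl ⟨n+1+i, by omega, by omega, rfl⟩)
  have h3 : (⟨0, 0, m * (c - m * ∑ i, a i * b i)⟩ : Heis n) ∈ S := by
    have := S.zpow_mem (h (Or.inr rfl) : zz n ^ m ∈ S) (c - m * ∑ i, a i * b i)
    rw [zz, pow_z, zpow_z] at this
    convert this using 2
    ring
  have := S.mul_mem (S.mul_mem h1 h2) h3
  convert this using 1
  ext i
  · simp [ha]
  · simp [hb]
  · simp [hc, mul_sub, Finset.mul_sum]
    rw [Finset.sum_congr rfl (fun i _ => show (m : ℤ) * a i * (m * b i) = m * (m * (a i * b i)) by ring)]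
    ring

lemma mem_N (n m : ℕ) (g : Heis n) : g ∈ Nsub n m ↔
    (∀ i, (m : ℤ) ∣ g.a i) ∧ (∀ i, (m : ℤ) ∣ g.b i) ∧ (m : ℤ) ∣ g.c := by
  refine ⟨fun h => ?_, fun h => mem_of_gens n m _ Subgroup.subset_closure g h.1 h.2.1 h.2.2⟩
  refine Subgroup.closure_induction (p := fun g _ => (∀ i, (m : ℤ) ∣ g.a i) ∧ (∀ i, (m : ℤ) ∣ g.b i) ∧ (m : ℤ) ∣ g.c) ?_ ?_ ?_ ?_ h
  · rintro x (⟨i, h1, h2, rfl⟩ | rfl)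
    · by_cases hi : i ≤ n
      · obtain ⟨i, rfl⟩ := Nat.exists_eq_add_of_le' h1
        rw [xg_lo n i (by omega), pow_lo]; simp
      · obtain ⟨i, rfl⟩ := Nat.exists_eq_add_of_lt (not_le.1 hi)
        rw [show n + i + 1 = n + 1 + i by ring, xg_hi n i (by omega), pow_hi]; simp
    · rw [zz, pow_z]; simp
  · simp
  · rintro x y _ _ ⟨h1, h2, h3⟩ ⟨h4, h5, h6⟩
    refine ⟨fun i => dvd_add (h1 i) (h4 i), fun i => dvd_add (h2 i) (h5 i), ?_⟩
    exact dvd_add (dvd_add h3 h6) (Finset.dvd_sum fun i _ => Dvd.dvd.mul_right (h1 i) _)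
  · rintro x _ ⟨h1, h2, h3⟩
    refine ⟨fun i => (dvd_neg.2 (h1 i)), fun i => (dvd_neg.2 (h2 i)), ?_⟩
    exact dvd_add (dvd_neg.2 h3) (Finset.dvd_sum fun i _ => Dvd.dvd.mul_right (h1 i) _)

lemma card_quot (n m : ℕ) (hm : 3 ≤ m) (N : Subgroup (Heis n)) (hN : N = Nsub n m) :
    Nat.card (Heis n ⧸ N) = m ^ (2 * n + 1) := by
  have : NeZero m := ⟨by omega⟩
  let f : Heis n → (Fin n → ZMod m) × (Fin n → ZMod m) × ZMod m :=
    fun g => (fun i => g.a i, fun i => g.b i, g.c)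
  have hf : ∀ x y : Heis n, x⁻¹ * y ∈ N ↔ f x = f y := by
    intro x y
    rw [hN, mem_N]
    simp only [f, Prod.mk.injEq, funext_iff, ZMod.intCast_eq_intCast_iff_dvd_sub]
    have e : (x⁻¹ * y).c = (y.c - x.c) - ∑ i, x.a i * (x⁻¹ * y).b i := by
      simp [mul_add, Finset.sum_add_distrib]; ring
    rw [e]
    have eb : ∀ i, (x⁻¹ * y).b i = y.b i - x.b i := by intro i; simp [neg_add_eq_sub]
    have ea : ∀ i, (x⁻¹ * y).a i = y.a i - x.a i := by intro i; simp [neg_add_eq_sub]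
    simp only [ea, eb]
    refine and_congr_right fun _ => and_congr_right fun h => ?_
    exact dvd_sub_left (Finset.dvd_sum fun i _ => Dvd.dvd.mul_left (h i) _)
  have hs : Function.Surjective f := by
    rintro ⟨u, v, w⟩
    refine ⟨⟨fun i => (u i).val, fun i => (v i).val, w.val⟩, ?_⟩
    simp [f]
  let F : Heis n ⧸ N → (Fin n → ZMod m) × (Fin n → ZMod m) × ZMod m :=
    Quotient.lift f (fun x y h => (hf x y).1 (QuotientGroup.leftRel_apply.1 h))
  have hF : Function.Bijective F := by
    constructor
    · intro p q
      induction p using QuotientGroup.induction_on with | _ x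
      induction q using QuotientGroup.induction_on with | _ y
      intro h
      exact QuotientGroup.eq.2 ((hf x y).2 h)
    · intro t
      obtain ⟨x, hx⟩ := hs t
      exact ⟨QuotientGroup.mk x, hx⟩
  rw [Nat.card_congr (Equiv.ofBijective F hF)]
  simp [Nat.card_prod, Nat.card_zmod]
  ring

lemma b_lo (n : ℕ) (hn : 1 ≤ n) (b : MulAut (Heis n)) (hb : IsB n b) (j : ℕ) (hj : j < n) :
    (b ^ j) (xg n (n+1)) = xg n (n + 1 + j) := by
  induction j with
  | zero => simp
  | succ j ih =>
    rw [pow_succ', MulAut.mul_apply, ih (by omega), hb.2.1 _ (by omega) (by omega)]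
    rfl

lemma b_n (n : ℕ) (hn : 1 ≤ n) (b : MulAut (Heis n)) (hb : IsB n b) :
    (b ^ n) (xg n (n+1)) =
     (xg n 1)⁻¹ * ((List.range n).map fun j => (xg n (n + 1 + j))⁻¹).prod := by
  obtain ⟨r, rfl⟩ := Nat.exists_eq_add_of_le' hn
  rw [pow_succ', MulAut.mul_apply, b_lo _ hn b hb r (by omega), ← hb.2.2]
  congr 2; ring

lemma b_n_a (n : ℕ) (hn : 1 ≤ n) (b : MulAut (Heis n)) (hb : IsB n b) :
    ((b ^ n) (xg n (n+1))).a = - Pi.single ⟨0, hn⟩ 1 := by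
  have : ∀ l : List ℕ, (∀ j ∈ l, j < n) → ((l.map fun j => (xg n (n + 1 + j))⁻¹).prod).a = 0 := by
    intro l hl
    induction l with
    | nil => simp
    | cons x l ih =>
      rw [List.map_cons, List.prod_cons, Heis.mul_a, ih (fun j hj => hl j (by simp [hj])),
        xg_hi n x (hl x (by simp))]
      simp
  rw [b_n n hn b hb, Heis.mul_a, this _ (by simp), xg_lo n 0 hn]
  simp

lemma b_n1 (n : ℕ) (hn : 1 ≤ n) (b : MulAut (Heis n)) (hb : IsB n b) :
    (b ^ (n+1)) (xg n (n+1)) = (b (xg n 1))⁻¹ * xg n (n+1) * xg n 1 := by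
  rw [pow_succ', MulAut.mul_apply, b_n n hn b hb]
  obtain ⟨r, rfl⟩ := Nat.exists_eq_add_of_le' hn
  set T := ((List.range r).map fun j => (xg (r+1) (r + 1 + 1 + 1 + j))⁻¹).prod with hT
  have e1 : ((List.range (r+1)).map fun j => (xg (r+1) (r + 1 + 1 + j))⁻¹).prod
      = (xg (r+1) (r+1+1))⁻¹ * T := by
    rw [List.range_succ_eq_map, List.map_cons, List.prod_cons, List.map_map, hT]
    congr 3
    funext j
    simp only [Function.comp]
    congr 2; omega
  have e2 : b ((List.range (r+1)).map fun j => (xg (r+1) (r + 1 + 1 + j))⁻¹).prod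
      = T * (b (xg (r+1) (2 * (r+1))))⁻¹ := by
    rw [List.range_succ, List.map_append, List.prod_append, map_mul, map_list_prod,
      List.map_map, hT]
    congr 1
    · congr 1
      apply List.map_congr_left
      intro j hj
      have := List.mem_range.1 hj
      simp only [Function.comp, map_inv]
      rw [hb.2.1 _ (by omega) (by omega)]
      congr 2; omega
    · simp only [List.map_cons, List.map_nil, List.prod_cons, List.prod_nil, mul_one, map_inv]
      congr 3; omega
  rw [map_mul, map_inv, e2, hb.2.2, e1]
  group

lemma b_mid (n : ℕ) (hn : 1 ≤ n) (b : MulAut (Heis n)) (hb : IsB n b) (i : ℕ) (hi : i + 1 < n) :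
    (b ^ (n+1+i)) (xg n (n+1)) = (xg n (i+2))⁻¹ * xg n (i+1) := by
  have comm : ∀ j, j + 1 < n → xg n (n+1) * xg n (j+2) = xg n (j+2) * xg n (n+1) := by
    intro j hj
    rw [xg_lo n (j+1) hj, show n + 1 = n + 1 + 0 by rfl, xg_hi n 0 (by omega)]
    ext <;> simp [Pi.single_apply]
  induction i with
  | zero =>
    rw [add_zero, b_n1 n hn b hb, hb.1 1 le_rfl (by omega)]
    have := comm 0 hi
    simp only [zero_add] at this ⊢
    rw [← this]; group
  | succ i ih =>
    rw [← add_assoc, pow_succ', MulAut.mul_apply, ih (by omega), map_mul, map_inv,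
      hb.1 _ (by omega) (by omega), hb.1 _ (by omega) (by omega), ]
    have h1 := comm i (by omega)
    have h2 := comm (i+1) (by omega)
    rw [show i + 1 + 1 = i + 2 by rfl, show i + 2 + 1 = i + 3 by rfl, ← h1]
    rw [show i + 1 + 2 = i + 3 by rfl] at h2 ⊢
    rw [← h2]; group

lemma b_2n (n : ℕ) (hn : 1 ≤ n) (b : MulAut (Heis n)) (hb : IsB n b) :
    (b ^ (2 * n)) (xg n (n+1)) = xg n n := by
  by_cases h1 : n = 1
  · subst h1
    have := b_n1 1 le_rfl b hb
    rw [hb.2.1 1 le_rfl (by norm_num)] at this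
    simpa using this
  · obtain ⟨r, rfl⟩ := Nat.exists_eq_add_of_le' (show 2 ≤ n by omega)
    rw [show 2 * (r + 2) = (r + 2 + 1 + r) + 1 by ring, pow_succ', MulAut.mul_apply,
      b_mid _ hn b hb r (by omega), map_mul, map_inv, hb.2.1 _ le_rfl (by omega),
      hb.1 _ (by omega) (by omega)]
    rw [show r + 1 + 1 = r + 2 by rfl, xg_lo (r+2) (r+1) (by omega),
      show r + 2 + 1 = r + 2 + 1 + 0 by rfl, xg_hi _ 0 (by omega)]
    ext <;> simp [Pi.single_apply]

lemma b_k (n : ℕ) (hn : 1 ≤ n) (b : MulAut (Heis n)) (hb : IsB n b) :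
    (b ^ (2 * n + 1)) (xg n (n+1)) = xg n (n+1) := by
  rw [pow_succ', MulAut.mul_apply, b_2n n hn b hb, hb.2.1 _ le_rfl (by omega)]

lemma b_coord (n : ℕ) (hn : 1 ≤ n) (b : MulAut (Heis n)) (hb : IsB n b) (l : ℕ) (h1 : 1 ≤ l)
    (h2 : l ≤ 2 * n) : ((b ^ l) (xg n (n+1))).b ⟨0, hn⟩ = 0 ∨
      ((b ^ l) (xg n (n+1))).a ⟨0, hn⟩ = -1 := by
  rcases lt_trichotomy l n with h | rfl | h
  · left; rw [b_lo n hn b hb l h, xg_hi n l h]; simp [Pi.single_apply]; omega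
  · right; rw [b_n_a l hn b hb]; simp
  · left
    by_cases h3 : l = 2 * n
    · rw [h3, b_2n n hn b hb]
      obtain ⟨r, rfl⟩ := Nat.exists_eq_add_of_le' hn
      rw [xg_lo _ r (by omega)]; simp
    · obtain ⟨i, rfl⟩ := Nat.exists_eq_add_of_lt h
      rw [show n + i + 1 = n + 1 + i by ring, b_mid n hn b hb i (by omega),
        xg_lo n (i+1) (by omega), xg_lo n i (by omega)]
      simp

lemma b_z (n : ℕ) (hn : 1 ≤ n) (b : MulAut (Heis n)) (hb : IsB n b) : b (zz n) = zz n := by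
  have h : xg n n * xg n (2 * n) = zz n * (xg n (2*n) * xg n n) := by
    obtain ⟨r, rfl⟩ := Nat.exists_eq_add_of_le' hn
    rw [show 2 * (r+1) = r + 1 + 1 + r by ring, xg_lo (r+1) r (by omega), xg_hi (r+1) r (by omega)]
    ext <;> simp [zz, Pi.single_apply]
  have h' := congrArg b h
  have hy : b (xg n (2*n)) = (b ^ n) (xg n (n+1)) := by rw [b_n n hn b hb, hb.2.2]
  rw [map_mul, map_mul, map_mul, hy, hb.2.1 _ le_rfl (by omega)] at h'
  have ha := b_n_a n hn b hb
  generalize (b ^ n) (xg n (n+1)) = y at *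
  have hx : xg n (n+1) = _ := xg_hi n 0 hn
  rw [hx, ← mul_inv_eq_iff_eq_mul] at h'
  rw [← h']
  ext i
  · simp [zz]
  · simp [zz]; ring
  · simp [zz, ha, Pi.single_apply]

lemma gen_top (n : ℕ) (hn : 1 ≤ n) (b : MulAut (Heis n)) (hb : IsB n b) (g : Heis n) :
    g ∈ Subgroup.closure {s | ∃ j < 2 * n + 1, s = (b ^ j) (xg n (n+1))} := by
  let S : ℕ → Subgroup (Heis n) := fun r => Subgroup.closure {s | ∃ j < r, s = (b ^ j) (xg n (n+1))}
  have mono : ∀ r s, r ≤ s → S r ≤ S s := fun r s h =>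
    Subgroup.closure_mono fun x ⟨j, hj, hx⟩ => ⟨j, hj.trans_le h, hx⟩
  have hS : ∀ r x, x ∈ S r → b x ∈ S (r+1) := by
    intro r x hx
    have : S r ≤ (S (r+1)).comap (b : Heis n →* Heis n) := by
      refine (Subgroup.closure_le _).2 ?_
      rintro _ ⟨j, hj, rfl⟩
      refine Subgroup.subset_closure ⟨j+1, by omega, ?_⟩
      rw [pow_succ']; rfl
    exact this hx
  have hhi : ∀ i < n, xg n (n + 1 + i) ∈ S n := fun i hi =>
    Subgroup.subset_closure ⟨i, hi, (b_lo n hn b hb i hi).symm⟩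
  have hlo : ∀ i < n, xg n (i+1) ∈ S (n + 1 + i) := by
    intro i hi
    induction i with
    | zero =>
      have h1 : (b ^ n) (xg n (n+1)) ∈ S (n+1) := Subgroup.subset_closure ⟨n, by omega, rfl⟩
      rw [b_n n hn b hb, Subgroup.mul_mem_cancel_right] at h1
      · simpa using h1
      · refine Subgroup.list_prod_mem _ ?_
        intro x hx
        obtain ⟨j, hj, rfl⟩ := List.mem_map.1 hx
        exact Subgroup.inv_mem _ (mono _ _ (by omega) (hhi j (List.mem_range.1 hj)))
    | succ i ih =>
      have := hS _ _ (ih (by omega))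
      rw [hb.1 _ (by omega) (by omega), Subgroup.mul_mem_cancel_right] at this
      · exact this
      · exact mono _ _ (by omega) (hhi 0 (by omega))
  have hlo' : ∀ i < n, xg n (i+1) ∈ S (2*n+1) := fun i hi => mono _ _ (by omega) (hlo i hi)
  have hhi' : ∀ i < n, xg n (n+1+i) ∈ S (2*n+1) := fun i hi => mono _ _ (by omega) (hhi i hi)
  refine mem_of_gens n 1 (S (2*n+1)) ?_ g (by simp) (by simp) (by simp)
  rintro x (⟨i, h1, h2, rfl⟩ | rfl)
  · rw [pow_one]
    by_cases hi : i ≤ n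
    · obtain ⟨i, rfl⟩ := Nat.exists_eq_add_of_le' h1
      exact hlo' i (by omega)
    · obtain ⟨i, rfl⟩ := Nat.exists_eq_add_of_lt (not_le.1 hi)
      rw [show n + i + 1 = n + 1 + i by ring]
      exact hhi' i (by omega)
  · rw [pow_one]
    have h := (S (2*n+1)).mul_mem ((S (2*n+1)).mul_mem (hlo' 0 hn) (hhi' 0 hn))
      ((S (2*n+1)).inv_mem ((S (2*n+1)).mul_mem (hhi' 0 hn) (hlo' 0 hn)))
    have e : zz n = xg n (0+1) * xg n (n+1+0) * (xg n (n+1+0) * xg n (0+1))⁻¹ := by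
      rw [xg_lo n 0 hn, xg_hi n 0 hn, zz]
      ext <;> simp [Pi.single_apply]
    rw [e]; exact h

lemma CayGrp_ind (n : ℕ) (b : MulAut (Heis n)) (N : Subgroup (Heis n)) [N.Normal]
    (hbN : Subgroup.map (b : Heis n →* Heis n) N = N)
    (K : Subgroup (Equiv.Perm (Heis n ⧸ N)))
    (h1 : ∀ h : Heis n ⧸ N, Equiv.mulRight h ∈ K)
    (h2 : (QuotientGroup.congr N N (b : Heis n ≃* Heis n) hbN).toEquiv ∈ K) :
    CayGrp n b N hbN ≤ K := by
  refine (Subgroup.closure_le _).2 ?_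
  rintro x (⟨h, rfl⟩ | rfl)
  · exact h1 h
  · exact h2

/-- For odd `m ≥ 3` and `k = 2n+1` prime: the Cayley digraph on `H_k/N_k` with
connection set the image of `P_k` is a connected oriented digraph of
out-valency `k` with exactly `m^k` vertices; the group generated by right
translations and the automorphism induced by `b` preserves arcs and acts
transitively on vertices and arcs; and the cosets of the image of `⟨z⟩` form a
system of blocks of imprimitivity of size `m` for this group. -/
theorem odd_case_digraph (n m k : ℕ) (hn : 1 ≤ n) (hk : k = 2 * n + 1)
    (hp : Nat.Prime k) (hm : 3 ≤ m) (hmo : Odd m)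
    (b : MulAut (Heis n)) (hb : IsB n b)
    (N : Subgroup (Heis n)) (hN : N = Nsub n m) [N.Normal]
    (hbN : Subgroup.map (b : Heis n →* Heis n) N = N) :
    Nat.card (Heis n ⧸ N) = m ^ k ∧
    (∀ u v : Heis n ⧸ N, Relation.EqvGen (PArc n k b N) u v) ∧
    (∀ u v : Heis n ⧸ N, PArc n k b N u v → ¬ PArc n k b N v u) ∧
    (∀ u : Heis n ⧸ N, {v | PArc n k b N u v}.ncard = k) ∧
    (∀ σ ∈ CayGrp n b N hbN, ∀ u v : Heis n ⧸ N,
      PArc n k b N u v → PArc n k b N (σ u) (σ v)) ∧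
    (∀ u v : Heis n ⧸ N, ∃ σ ∈ CayGrp n b N hbN, σ u = v) ∧
    (∀ u v u' v' : Heis n ⧸ N, PArc n k b N u v → PArc n k b N u' v' →
      ∃ σ ∈ CayGrp n b N hbN, σ u = u' ∧ σ v = v') ∧
    (∀ g : Heis n ⧸ N, (zCoset n N g).ncard = m) ∧
    (∀ σ ∈ CayGrp n b N hbN, ∀ g : Heis n ⧸ N,
      ∃ g' : Heis n ⧸ N, σ '' zCoset n N g = zCoset n N g') := by
  subst hk
  set y : ℕ → Heis n ⧸ N := fun j => QuotientGroup.mk ((b ^ j) (xg n (n + 1))) with hy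
  set β := QuotientGroup.congr N N (b : Heis n ≃* Heis n) hbN with hβ
  have hβm : ∀ x : Heis n, β (QuotientGroup.mk x) = QuotientGroup.mk (b x) := fun x => rfl
  have hβy : ∀ j, β (y j) = y (j+1) := by
    intro j
    simp only [hy, hβm, pow_succ', MulAut.mul_apply]
  have hyk : y (2*n+1) = y 0 := by
    simp only [hy, b_k n hn b hb, pow_zero, MulAut.one_apply]
  have hβp : ∀ i j, (β ^ i : MulAut (Heis n ⧸ N)) (y j) = y (i + j) := by
    intro i j
    induction i with
    | zero => simp
    | succ i ih => rw [pow_succ', MulAut.mul_apply, ih, hβy]; congr 1; ring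
  have hyper : ∀ i, y (i + (2*n+1)) = y i := by
    intro i
    rw [← hβp, hyk, hβp, add_zero]
  have hNa : ∀ g ∈ N, (m : ℤ) ∣ g.a ⟨0, hn⟩ ∧ (m : ℤ) ∣ g.b ⟨0, hn⟩ := by
    intro g hg
    rw [hN, mem_N] at hg
    exact ⟨hg.1 _, hg.2.1 _⟩
  have hx0 : xg n (n+1) = ⟨0, Pi.single ⟨0, hn⟩ 1, 0⟩ := xg_hi n 0 hn
  have nd : ∀ t : ℤ, t ≠ 0 → |t| < m → ¬ (m : ℤ) ∣ t := by
    intro t ht hlt hd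
    exact ht (Int.eq_zero_of_abs_lt_dvd hd hlt)
  have hm' : (3 : ℤ) ≤ m := by exact_mod_cast hm
  -- distinctness and asymmetry at zero
  have hd0 : ∀ l, 1 ≤ l → l ≤ 2 * n → y 0 ≠ y l := by
    intro l h1 h2 h
    have := hNa _ (QuotientGroup.eq.1 h)
    simp only [pow_zero, MulAut.one_apply, hx0, Heis.mul_a, Heis.mul_b, Heis.inv_a, Heis.inv_b,
      Pi.add_apply, Pi.neg_apply, Pi.single_eq_same, Pi.zero_apply] at this
    rw [← hx0] at this
    rcases b_coord n hn b hb l h1 h2 with h3 | h3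
    · rw [h3] at this
      exact nd _ (by norm_num) (by norm_num; omega) this.2
    · rw [h3] at this
      exact nd _ (by norm_num) (by norm_num; omega) this.1
  have ha0 : ∀ l, l ≤ 2 * n → y 0 * y l ≠ 1 := by
    intro l h2 h
    have h' : (QuotientGroup.mk (xg n (n+1) * (b ^ l) (xg n (n + 1))) : Heis n ⧸ N) = 1 := h
    have := hNa _ ((QuotientGroup.eq_one_iff _).1 h')
    have e1 : (xg n (n+1)).a ⟨0, hn⟩ = 0 := by rw [hx0]; rfl
    have e2 : (xg n (n+1)).b ⟨0, hn⟩ = 1 := by rw [hx0]; simp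
    simp only [Heis.mul_a, Heis.mul_b, Pi.add_apply, e1, e2] at this
    rcases Nat.eq_zero_or_pos l with rfl | h1
    · simp only [pow_zero, MulAut.one_apply, e2] at this
      exact nd _ (by norm_num) (by norm_num; omega) this.2
    rcases b_coord n hn b hb l h1 h2 with h3 | h3
    · rw [h3] at this
      exact nd _ (by norm_num) (by norm_num; omega) this.2
    · rw [h3] at this
      exact nd _ (by norm_num) (by norm_num; omega) this.1
  have hinj : ∀ i j, i < j → j < 2 * n + 1 → y i ≠ y j := by
    intro i j hij hj h
    have e1 : y i = (β ^ i : MulAut (Heis n ⧸ N)) (y 0) := by rw [hβp, add_zero]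
    have e2 : y j = (β ^ i : MulAut (Heis n ⧸ N)) (y (j - i)) := by rw [hβp]; congr 1; omega
    rw [e1, e2] at h
    exact hd0 (j-i) (by omega) (by omega) ((β ^ i : MulAut (Heis n ⧸ N)).injective h)
  have hasym' : ∀ i j, i ≤ j → j < 2 * n + 1 → y i * y j ≠ 1 := by
    intro i j hij hj h
    have e1 : y i = (β ^ i : MulAut (Heis n ⧸ N)) (y 0) := by rw [hβp, add_zero]
    have e2 : y j = (β ^ i : MulAut (Heis n ⧸ N)) (y (j - i)) := by rw [hβp]; congr 1; omega
    rw [e1, e2, ← map_mul] at h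
    refine ha0 (j-i) (by omega) ((β ^ i : MulAut (Heis n ⧸ N)).injective ?_)
    rw [h, map_one]
  have hasym : ∀ i j, i < 2 * n + 1 → j < 2 * n + 1 → y i * y j ≠ 1 := by
    intro i j hi hj h
    rcases le_total i j with hij | hij
    · exact hasym' i j hij hj h
    · exact hasym' j i hij hi (mul_eq_one_comm.1 h)
  have hR : ∀ h : Heis n ⧸ N, Equiv.mulRight h ∈ CayGrp n b N hbN := fun h =>
    Subgroup.subset_closure (Or.inl ⟨h, rfl⟩)
  have hB : β.toEquiv ∈ CayGrp n b N hbN := Subgroup.subset_closure (Or.inr rfl)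
  have hBp : ∀ j : ℕ, ∀ u, (β.toEquiv ^ j) u = (β ^ j : MulAut (Heis n ⧸ N)) u := by
    intro j
    induction j with
    | zero => intro u; rfl
    | succ j ih => intro u; rw [pow_succ', pow_succ', Equiv.Perm.mul_apply, ih]; rfl
  have hz : ∀ c : ℤ, β (QuotientGroup.mk (zz n ^ c)) = QuotientGroup.mk (zz n ^ c) := by
    intro c
    rw [hβm, map_zpow, b_z n hn b hb]
  have hcomm : ∀ σ ∈ CayGrp n b N hbN, ∀ (c : ℤ) (g : Heis n ⧸ N),
      σ ((QuotientGroup.mk (zz n ^ c)) * g) = (QuotientGroup.mk (zz n ^ c)) * σ g := by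
    let K : Subgroup (Equiv.Perm (Heis n ⧸ N)) :=
      { carrier := {σ | ∀ (c : ℤ) (g : Heis n ⧸ N),
          σ ((QuotientGroup.mk (zz n ^ c)) * g) = (QuotientGroup.mk (zz n ^ c)) * σ g}
        one_mem' := fun c g => rfl
        mul_mem' := by
          intro σ τ hσ hτ c g
          rw [Equiv.Perm.mul_apply, hτ, hσ]; rfl
        inv_mem' := by
          intro σ hσ c g
          have e : σ (σ⁻¹ g) = g := σ.apply_symm_apply g
          rw [Equiv.Perm.inv_eq_iff_eq, hσ, e] }
    refine CayGrp_ind n b N hbN K ?_ ?_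
    · intro h c g
      exact mul_assoc _ _ _
    · intro c g
      change β _ = _ * β _
      rw [map_mul, hz]
  refine ⟨card_quot n m hm N hN, ?_, ?_, ?_, ?_, ?_, ?_, ?_, ?_⟩
  · have key : ∀ g : Heis n, ∀ u : Heis n ⧸ N,
        Relation.EqvGen (PArc n (2*n+1) b N) u (QuotientGroup.mk g * u) := by
      intro g
      refine Subgroup.closure_induction (p := fun g _ => ∀ u : Heis n ⧸ N,
        Relation.EqvGen (PArc n (2*n+1) b N) u (QuotientGroup.mk g * u)) ?_ ?_ ?_ ?_
        (gen_top n hn b hb g)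
      · rintro _ ⟨j, hj, rfl⟩ u
        exact Relation.EqvGen.rel _ _ ⟨j, hj, rfl⟩
      · intro u
        rw [QuotientGroup.mk_one, one_mul]
        exact Relation.EqvGen.refl _
      · intro x y _ _ hx hy u
        rw [QuotientGroup.mk_mul, mul_assoc]
        exact (hy u).trans _ _ _ (hx _)
      · intro x _ hx u
        have := hx (QuotientGroup.mk x⁻¹ * u)
        rw [← mul_assoc, ← QuotientGroup.mk_mul, mul_inv_cancel, QuotientGroup.mk_one,
          one_mul] at this
        exact this.symm
    intro u v
    obtain ⟨g, hg⟩ := QuotientGroup.mk_surjective (v * u⁻¹)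
    have := key g u
    rwa [hg, inv_mul_cancel_right] at this
  · rintro u v ⟨i, hi, h1⟩ ⟨j, hj, h2⟩
    rw [h1, ← mul_assoc] at h2
    exact hasym j i hj hi (mul_eq_right.1 h2.symm)
  · intro u
    have : {v | PArc n (2*n+1) b N u v} = (fun j => y j * u) '' (Finset.range (2*n+1) : Set ℕ) := by
      ext v
      constructor
      · rintro ⟨j, hj, h⟩
        exact ⟨j, by simpa using hj, h.symm⟩
      · rintro ⟨j, hj, h⟩
        exact ⟨j, by simpa using hj, h.symm⟩
    rw [this, Set.InjOn.ncard_image, Set.ncard_coe_finset, Finset.card_range]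
    intro i hi j hj h
    have h' : y i = y j := mul_right_cancel h
    have hi : i < 2*n+1 := by simpa using hi
    have hj : j < 2*n+1 := by simpa using hj
    by_contra hne
    rcases lt_or_gt_of_ne hne with hlt | hlt
    · exact hinj i j hlt hj h'
    · exact hinj j i hlt hi h'.symm
  · let K : Subgroup (Equiv.Perm (Heis n ⧸ N)) :=
      { carrier := {σ | ∀ u v : Heis n ⧸ N,
          PArc n (2*n+1) b N u v ↔ PArc n (2*n+1) b N (σ u) (σ v)}
        one_mem' := fun u v => Iff.rfl
        mul_mem' := by
          intro σ τ hσ hτ u v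
          exact (hτ u v).trans (hσ _ _)
        inv_mem' := by
          intro σ hσ u v
          have := hσ (σ⁻¹ u) (σ⁻¹ v)
          have e : ∀ g, σ (σ⁻¹ g) = g := σ.apply_symm_apply
          rw [e, e] at this
          exact this.symm }
    have hK : CayGrp n b N hbN ≤ K := by
      refine CayGrp_ind n b N hbN K ?_ ?_
      · intro h u v
        refine exists_congr fun j => and_congr_right fun _ => ?_
        change _ ↔ v * h = _ * (u * h)
        rw [← mul_assoc]
        exact (mul_left_inj h).symm
      · intro u v
        constructor
        · rintro ⟨j, hj, h⟩
          have h' : β v = y (j+1) * β u := by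
            rw [← hβy, ← map_mul]; exact congrArg β h
          by_cases hj2 : j = 2 * n
          · refine ⟨0, by omega, ?_⟩
            rw [hj2, hyk] at h'
            exact h'
          · exact ⟨j+1, by omega, h'⟩
        · rintro ⟨j, hj, h⟩
          have h' : β v = y j * β u := h
          obtain ⟨i, hi, e⟩ : ∃ i < 2*n+1, y j = y (i+1) := by
            rcases Nat.eq_zero_or_pos j with rfl | hpos
            · exact ⟨2*n, by omega, hyk.symm⟩
            · exact ⟨j-1, by omega, by congr 1; omega⟩
          rw [e, ← hβy, ← map_mul] at h'
          exact ⟨i, hi, β.injective h'⟩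
    exact fun σ hσ u v h => (hK hσ u v).1 h
  · intro u v
    exact ⟨Equiv.mulRight (u⁻¹ * v), hR _, by simp⟩
  · rintro u v u' v' ⟨i, hi, h1⟩ ⟨j, hj, h2⟩
    have key : ∀ l, ∃ τ ∈ CayGrp n b N hbN, τ 1 = 1 ∧ τ (y 0) = y l := by
      intro l
      refine ⟨β.toEquiv ^ l, Subgroup.pow_mem _ hB l, ?_, ?_⟩
      · rw [hBp, map_one]
      · rw [hBp, hβp, add_zero]
    obtain ⟨τ, hτ, t1, t2⟩ := key i
    obtain ⟨ρ, hρ, r1, r2⟩ := key j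
    refine ⟨Equiv.mulRight u' * ρ * τ⁻¹ * Equiv.mulRight u⁻¹,
      mul_mem (mul_mem (mul_mem (hR _) hρ) (inv_mem hτ)) (hR _), ?_, ?_⟩
    · have : τ⁻¹ 1 = 1 := by rw [Equiv.Perm.inv_eq_iff_eq, t1]
      simp only [Equiv.Perm.mul_apply, Equiv.coe_mulRight, mul_inv_cancel, this, r1, one_mul]
    · have : τ⁻¹ (y i) = y 0 := by rw [Equiv.Perm.inv_eq_iff_eq, t2]
      have h1' : v * u⁻¹ = y i := by rw [h1, mul_inv_cancel_right]
      simp only [Equiv.Perm.mul_apply, Equiv.coe_mulRight, h1', this, r2]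
      exact h2.symm
  · intro g
    have e : zCoset n N g = (fun x => x * g) '' (Subgroup.zpowers (QuotientGroup.mk (zz n) : Heis n ⧸ N) : Set (Heis n ⧸ N)) := by
      ext q
      constructor
      · rintro ⟨c, rfl⟩
        exact ⟨_, ⟨c, rfl⟩, rfl⟩
      · rintro ⟨_, ⟨c, rfl⟩, rfl⟩
        exact ⟨c, rfl⟩
    rw [e, Set.ncard_image_of_injective _ (mul_left_injective g)]
    have e2 : ∀ c : ℕ, (QuotientGroup.mk (zz n) : Heis n ⧸ N) ^ c = 1 ↔ m ∣ c := by
      intro c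
      rw [← QuotientGroup.mk_pow, QuotientGroup.eq_one_iff, hN, mem_N, zz, pow_z]
      simp [Int.natCast_dvd_natCast]
    have e3 : orderOf (QuotientGroup.mk (zz n) : Heis n ⧸ N) = m :=
      Nat.dvd_antisymm (orderOf_dvd_of_pow_eq_one ((e2 m).2 dvd_rfl))
        ((e2 _).1 (pow_orderOf_eq_one _))
    rw [← Nat.card_coe_set_eq]
    exact (Nat.card_zpowers _).trans e3
  · intro σ hσ g
    refine ⟨σ g, ?_⟩
    ext q
    constructor
    · rintro ⟨_, ⟨c, rfl⟩, rfl⟩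
      exact ⟨c, hcomm σ hσ c g⟩
    · rintro ⟨c, rfl⟩
      exact ⟨_, ⟨c, rfl⟩, hcomm σ hσ c g⟩
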